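/- arXiv:2103.07035 — 2 statements merged into one kernel-verified Lean document; each statement's English description precedes it below -/
import Mathlib

section
/- Let V be a finite-dimensional ℚ-vector space with a positive definite symmetric bilinear form ⟪·,·⟫, and let L ⊆ V be a ℤ-submodule that is even (⟪x,x⟫ ∈ 2ℤ for all x ∈ L) and has no roots, i.e. no x ∈ L with ⟪x,x⟫ = 2. Let λ ∈ V with 2λ ∈ L. Then for any α, β in the coset λ + L with ⟪α,α⟫ = ⟪β,β⟫ = 2, one has ⟪α,β⟫ ∈ {2, -2, 0}, with ⟪α,β⟫ = 2 if and only if β = α, and ⟪α,β⟫ = -2 if and only if β = -α; in particular any two norm-2 vectors of λ + L are either proportional or orthogonal, so the norm-2 vectors of λ + L form a root system whose components are all of type A₁. -/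
/-- Let `L` be an even rootless ℤ-submodule of a finite-dimensional ℚ-vector
space with positive definite symmetric bilinear form `B`, and `lam` with
`2·lam ∈ L`.  Then any two norm-2 vectors `α, β` of the coset `lam + L`
satisfy `B α β ∈ {2, -2, 0}`, with `B α β = 2` iff `β = α` and `B α β = -2`
iff `β = -α`; so the norm-2 vectors of `lam + L` form a root system of type `A₁ⁿ`. -/
theorem coset_norm_two_vectors_A1
    (V : Type*) [AddCommGroup V] [Module ℚ V] [FiniteDimensional ℚ V]
    (B : V →ₗ[ℚ] V →ₗ[ℚ] ℚ) (hsymm : ∀ x y : V, B x y = B y x)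
    (hpos : ∀ x : V, x ≠ 0 → 0 < B x x)
    (L : Submodule ℤ V)
    (heven : ∀ x ∈ L, ∃ k : ℤ, B x x = 2 * k)
    (hrootless : ∀ x ∈ L, B x x ≠ 2)
    (lam : V) (hlam : (2 : ℤ) • lam ∈ L) :
    ∀ α β : V, α - lam ∈ L → β - lam ∈ L → B α α = 2 → B β β = 2 →
      (B α β = 2 ∨ B α β = -2 ∨ B α β = 0) ∧
      (B α β = 2 ↔ β = α) ∧ (B α β = -2 ↔ β = -α) := by
  intro α β hα hβ ha hb
  have hm : α - β ∈ L := by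
    have h := L.sub_mem hα hβ
    rwa [sub_sub_sub_cancel_right] at h
  have hp : α + β ∈ L := by
    have h := L.add_mem (L.add_mem hα hβ) hlam
    have e : α - lam + (β - lam) + (2 : ℤ) • lam = α + β := by
      rw [two_zsmul]; abel
    rwa [e] at h
  have nm : B (α - β) (α - β) = 4 - 2 * B α β := by
    simp only [map_sub, LinearMap.sub_apply, ha, hb, hsymm β α]; ring
  have np : B (α + β) (α + β) = 4 + 2 * B α β := by
    simp only [map_add, LinearMap.add_apply, ha, hb, hsymm β α]; ring
  have nonneg : ∀ x : V, 0 ≤ B x x := by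
    intro x
    by_cases hx : x = 0
    · simp [hx]
    · exact (hpos x hx).le
  obtain ⟨k, hk⟩ := heven _ hm
  have rm := hrootless _ hm
  have rp := hrootless _ hp
  have zm := nonneg (α - β)
  have zp := nonneg (α + β)
  have hB : B α β = 2 - k := by linarith
  refine ⟨?_, ⟨fun h => ?_, fun h => ?_⟩, ⟨fun h => ?_, fun h => ?_⟩⟩
  · rw [nm, hB] at rm zm
    rw [np, hB] at rp zp
    have k0 : 0 ≤ k := by
      have : (0 : ℚ) ≤ k := by linarith
      exact_mod_cast this
    have k4 : k ≤ 4 := by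
      have : (k : ℚ) ≤ 4 := by linarith
      exact_mod_cast this
    rw [hB]
    interval_cases k <;> norm_num at *
  · by_contra hne
    have := hpos (α - β) (fun h0 => hne (sub_eq_zero.mp h0).symm)
    linarith
  · rw [h, ha]
  · by_contra hne
    have := hpos (α + β) (fun h0 => hne (eq_neg_of_add_eq_zero_right h0))
    linarith
  · rw [h, map_neg, ha]
end

section
/- Let V be an n-dimensional ℚ-vector space with a positive definite symmetric bilinear form ⟪·,·⟫, let L ⊆ V be a full-rank ℤ-submodule with dual lattice L* = {v ∈ V : ⟪v,x⟫ ∈ ℤ for all x ∈ L}, and let g be a ℚ-linear isometry of V with g ∘ g = -id and g(L) = L. If (1 - g)L* = L (i.e. the image of L* under id - g equals L), then the quotient L*/L is finite of cardinality 2^(n/2); in other words, |L*/L| = |L/(1-g)L| = |det(1-g)| = 2^(n/2). -/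
open Module in
/-- A `ℤ`-submodule all of whose vectors pair integrally with a spanning set is finitely generated. -/
theorem aux_dual_fg
    {V : Type*} [AddCommGroup V] [Module ℚ V] [FiniteDimensional ℚ V]
    (B : V →ₗ[ℚ] V →ₗ[ℚ] ℚ) (hpos : ∀ x : V, x ≠ 0 → 0 < B x x)
    (L : Submodule ℤ V) (hfull : Submodule.span ℚ (L : Set V) = ⊤)
    (Ldual : Submodule ℤ V)
    (hdual : ∀ v : V, v ∈ Ldual ↔ ∀ x ∈ L, ∃ k : ℤ, B v x = (k : ℚ)) : Ldual.FG := by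
  classical
  have hB : LinearMap.BilinForm.Nondegenerate B := by
    constructor
    · intro x hx
      by_contra h
      exact (hpos x h).ne' (hx x)
    · intro x hx
      by_contra h
      exact (hpos x h).ne' (hx x)
  let b := Basis.ofSpan hfull.ge
  have hbL : ∀ i, b i ∈ L := fun i => Basis.ofSpan_subset hfull.ge ⟨i, rfl⟩
  have : Finite _ := Module.Finite.finite_basis b
  have hle : Ldual ≤ LinearMap.BilinForm.dualSubmodule B (Submodule.span ℤ (Set.range b)) := by
    intro v hv x hx
    have hx' : x ∈ L := by
      refine Submodule.span_le.2 ?_ hx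
      rintro _ ⟨i, rfl⟩
      exact hbL i
    obtain ⟨k, hk⟩ := (hdual v).1 hv x hx'
    exact Submodule.mem_one.2 ⟨k, by simp [hk]⟩
  rw [LinearMap.BilinForm.dualSubmodule_span_of_basis B hB b] at hle
  have hfg : (Submodule.span ℤ (Set.range (LinearMap.BilinForm.dualBasis B hB b))).FG :=
    Submodule.fg_span (Set.finite_range _)
  have : IsNoetherian ℤ (Submodule.span ℤ (Set.range (LinearMap.BilinForm.dualBasis B hB b))) :=
    isNoetherian_of_fg_of_noetherian _ hfg
  have := isNoetherian_of_le hle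
  exact Module.Finite.iff_fg.1 inferInstance

open Module in
/-- A finitely generated spanning `ℤ`-submodule has a `ℤ`-basis which is a `ℚ`-basis of `V`. -/
theorem aux_basis
    {V : Type*} [AddCommGroup V] [Module ℚ V] [FiniteDimensional ℚ V]
    (L : Submodule ℤ V) (hfull : Submodule.span ℚ (L : Set V) = ⊤) (hfg : L.FG) :
    ∃ (n : ℕ) (b : Basis (Fin n) ℚ V), L.toAddSubgroup = AddSubgroup.closure (Set.range b) := by
  have : Module.Finite ℤ L := Module.Finite.iff_fg.2 hfg
  have : IsAddTorsionFree V := IsAddTorsionFree.of_module_rat V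
  let b₁ := Module.finBasis ℤ L
  let b₂ := ((b₁.baseChange ℚ).map (L.tensorEquivSpan ℚ)).map
    ((LinearEquiv.ofEq _ _ hfull).trans Submodule.topEquiv)
  have hb : ∀ i, b₂ i = (b₁ i : V) := by
    intro i
    simp [b₂]
  refine ⟨_, b₂, ?_⟩
  have hL : L = Submodule.span ℤ (Set.range b₂) := by
    have h := congrArg (Submodule.map L.subtype) b₁.span_eq
    rw [Submodule.map_span, ← Set.range_comp, Submodule.map_top, Submodule.range_subtype] at h
    refine h.symm.trans ?_
    congr 2
    ext i
    simp [hb]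
  exact (congrArg Submodule.toAddSubgroup hL).trans (Submodule.span_int_eq_addSubgroupClosure _)

/-- The index of the image of a lattice under a linear automorphism. -/
theorem aux_card
    {V : Type*} [AddCommGroup V] [Module ℚ V] [FiniteDimensional ℚ V]
    (L : Submodule ℤ V) (hfull : Submodule.span ℚ (L : Set V) = ⊤) (hfg : L.FG)
    (f : V →ₗ[ℚ] V) (hf : LinearMap.det f ≠ 0)
    (hle : Submodule.map (f.restrictScalars ℤ) L ≤ L) :
    (Nat.card (L ⧸ Submodule.comap L.subtype (Submodule.map (f.restrictScalars ℤ) L)) : ℚ)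
      = |LinearMap.det f| := by
  obtain ⟨n, b, hb⟩ := aux_basis L hfull hfg
  let e := LinearMap.equivOfDetNeZero f hf
  have he : ∀ x, e x = f x := fun x => rfl
  have key := AddSubgroup.relIndex_eq_abs_det
    (Submodule.map (f.restrictScalars ℤ) L).toAddSubgroup L.toAddSubgroup hle (b.map e) b
    (by
      have h1 : (Submodule.map (f.restrictScalars ℤ) L).toAddSubgroup
          = L.toAddSubgroup.map f.toAddMonoidHom := by
        ext x; simp
      rw [h1, hb, AddMonoidHom.map_closure, ← Set.range_comp]
      congr 2) hb
  have hdet : b.det (b.map e) = LinearMap.det f := by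
    have := Module.Basis.det_comp b f b
    rw [b.det_self, mul_one] at this
    rw [← this]
    congr 1
  rw [hdet] at key
  rw [← key]
  rfl

/-- Let `L` be a full-rank ℤ-submodule of an `n`-dimensional ℚ-vector space
with positive definite symmetric bilinear form `B`, with dual lattice `L*`,
and let `g` be an isometry with `g² = -id` and `g(L) = L`.  If `(1-g)L* = L`,
then `|L*/L| = |L/(1-g)L| = |det(1-g)| = 2^(n/2)`. -/
theorem card_dual_quotient_of_one_sub_fourvolution_dual_eq
    (V : Type*) [AddCommGroup V] [Module ℚ V] [FiniteDimensional ℚ V]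
    (B : V →ₗ[ℚ] V →ₗ[ℚ] ℚ) (hsymm : ∀ x y : V, B x y = B y x)
    (hpos : ∀ x : V, x ≠ 0 → 0 < B x x)
    (L : Submodule ℤ V) (hfull : Submodule.span ℚ (L : Set V) = ⊤)
    (Ldual : Submodule ℤ V)
    (hdual : ∀ v : V, v ∈ Ldual ↔ ∀ x ∈ L, ∃ k : ℤ, B v x = (k : ℚ))
    (g : V ≃ₗ[ℚ] V) (hiso : ∀ u v : V, B (g u) (g v) = B u v)
    (hg : ∀ v : V, g (g v) = -v)
    (hgL : Submodule.map ((g : V →ₗ[ℚ] V).restrictScalars ℤ) L = L)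
    (hdualL : Submodule.map (((LinearMap.id - (g : V →ₗ[ℚ] V))).restrictScalars ℤ) Ldual = L) :
    Nat.card (Ldual ⧸ Submodule.comap Ldual.subtype L)
        = 2 ^ (Module.finrank ℚ V / 2) ∧
    Nat.card (L ⧸ Submodule.comap L.subtype
        (Submodule.map (((LinearMap.id - (g : V →ₗ[ℚ] V))).restrictScalars ℤ) L))
        = 2 ^ (Module.finrank ℚ V / 2) ∧
    |LinearMap.det (LinearMap.id - (g : V →ₗ[ℚ] V))|
        = 2 ^ (Module.finrank ℚ V / 2) := by
  classical
  set N : V →ₗ[ℚ] V := LinearMap.id - (g : V →ₗ[ℚ] V) with hN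
  have hNa : ∀ x, N x = x - g x := fun x => by simp [hN]
  -- parity and determinants
  have hgg : (g : V →ₗ[ℚ] V) ∘ₗ (g : V →ₗ[ℚ] V) = (-1 : ℚ) • LinearMap.id := by
    ext v; simp [hg]
  have hdg : LinearMap.det (g : V →ₗ[ℚ] V) ^ 2 = (-1) ^ (Module.finrank ℚ V) := by
    have := congrArg LinearMap.det hgg
    rw [LinearMap.det_comp, LinearMap.det_smul, LinearMap.det_id, mul_one] at this
    rw [sq, this]
  have heven : Even (Module.finrank ℚ V) := by
    by_contra h
    rw [Nat.not_even_iff_odd] at h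
    rw [h.neg_one_pow] at hdg
    nlinarith [sq_nonneg (LinearMap.det (g : V →ₗ[ℚ] V))]
  have hNN : N ∘ₗ N = (-2 : ℚ) • (g : V →ₗ[ℚ] V) := by
    ext v
    simp only [LinearMap.comp_apply, hNa, map_sub, hg, LinearMap.smul_apply, LinearEquiv.coe_coe]
    module
  have hdN : LinearMap.det N ^ 2
      = 2 ^ (Module.finrank ℚ V) * LinearMap.det (g : V →ₗ[ℚ] V) := by
    have := congrArg LinearMap.det hNN
    rw [LinearMap.det_comp, LinearMap.det_smul, heven.neg_pow] at this
    rw [sq, this]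
  have hdetabs : |LinearMap.det N| = 2 ^ (Module.finrank ℚ V / 2) := by
    rw [heven.neg_one_pow] at hdg
    obtain ⟨m, hm⟩ := heven
    have hm2 : Module.finrank ℚ V / 2 = m := by omega
    have hp : (0 : ℚ) < 2 ^ (Module.finrank ℚ V) := by positivity
    rcases sq_eq_sq_iff_eq_or_eq_neg.1 (hdg.trans (one_pow 2).symm) with h | h
    · rw [h, mul_one, hm, ← two_mul, mul_comm 2 m, pow_mul] at hdN
      rw [hm2, (sq_eq_sq_iff_abs_eq_abs _ _).1 hdN, abs_of_pos (by positivity)]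
    · rw [h] at hdN
      nlinarith [sq_nonneg (LinearMap.det N)]
  have hdet0 : LinearMap.det N ≠ 0 := by
    intro h
    rw [h, abs_zero] at hdetabs
    exact absurd hdetabs (by positivity)
  have hinj : Function.Injective N := (LinearMap.equivOfDetNeZero N hdet0).injective
  have hfg : L.FG := by
    rw [← hdualL]
    exact (aux_dual_fg B hpos L hfull Ldual hdual).map _
  have hle : Submodule.map (N.restrictScalars ℤ) L ≤ L := by
    rintro _ ⟨x, hx, rfl⟩
    have hgx : g x ∈ L := by
      have : ((g : V →ₗ[ℚ] V).restrictScalars ℤ) x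
          ∈ Submodule.map ((g : V →ₗ[ℚ] V).restrictScalars ℤ) L := ⟨x, hx, rfl⟩
      rw [hgL] at this
      exact this
    have : N x ∈ L := by
      rw [hNa]; exact L.sub_mem hx hgx
    exact this
  have hcard : Nat.card (L ⧸ Submodule.comap L.subtype (Submodule.map (N.restrictScalars ℤ) L))
      = 2 ^ (Module.finrank ℚ V / 2) := by
    have := aux_card L hfull hfg N hdet0 hle
    rw [hdetabs] at this
    exact_mod_cast this
  refine ⟨?_, hcard, hdetabs⟩
  rw [← hcard]
  let e : Ldual ≃ₗ[ℤ] L :=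
    (Submodule.equivMapOfInjective (N.restrictScalars ℤ) hinj Ldual).trans
      (LinearEquiv.ofEq _ _ hdualL)
  have he : ∀ x : Ldual, ((e x : L) : V) = N x := fun x => rfl
  refine Nat.card_congr (Submodule.Quotient.equiv _ _ e ?_).toEquiv
  ext y
  constructor
  · rintro ⟨x, hx, rfl⟩
    exact ⟨x, hx, rfl⟩
  · rintro ⟨x, hx, hxy⟩
    obtain ⟨z, rfl⟩ := e.surjective y
    refine ⟨z, ?_, rfl⟩
    have : x = z := hinj hxy
    change (z : V) ∈ L
    rw [← this]
    exact hx
end
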